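/- Let Θ be a countable model with prior π, fix η with 1/2 ≤ η < 1 such that Σ_{θ∈Θ} π(θ)^η < ∞, and let b > 0 and n ≥ 2. Set ε = (b log n)/(nη), c_η = (1−η)/(1 + η(1−η)), and for θ* ∈ Θ let Θ̄_{η,ε}(θ*) = { θ ∈ Θ : d_η(θ* ‖ θ) > ε }. Then the Bayesian joint probability Π( (θ*, Z^n) : Σ_{θ ∈ Θ̄_{η,ε}(θ*)} π(θ | Z^n) ≥ n^{−b c_η} ) ≤ 2 (Σ_{θ∈Θ} π(θ)^η) · n^{−b c_η}. (Lemma 1: the Bayesian believes the posterior concentrates in Rényi divergence.) -/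

import Mathlib

open MeasureTheory ENNReal

noncomputable section

/-- Unnormalized posterior weight of `θ` given the sample `z`. -/
def postNum {Z : Type*} {Θ : Type*} (π : Θ → ℝ) (f : Θ → Z → ℝ) {n : ℕ}
    (z : Fin n → Z) (θ : Θ) : ℝ :=
  π θ * ∏ i, f θ (z i)

/-- The Bayesian posterior of `θ` given the sample `z`. -/
def post {Z : Type*} {Θ : Type*} (π : Θ → ℝ) (f : Θ → Z → ℝ) {n : ℕ}
    (z : Fin n → Z) (θ : Θ) : ℝ :=
  postNum π f z θ / ∑' θ', postNum π f z θ'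

/-- The Rényi divergence of order `1 - η`:
`d_η(θ* ‖ θ) = -(1/η) log ∫ f_{θ*}^{1-η} f_θ^η dρ`. -/
def renyi {Z : Type*} [MeasurableSpace Z] (ρ : Measure Z) {Θ : Type*}
    (f : Θ → Z → ℝ) (η : ℝ) (θstar θ : Θ) : ℝ :=
  -(1 / η) * Real.log (∫ x, f θstar x ^ (1 - η) * f θ x ^ η ∂ρ)

/-- The Bayesian joint probability `Π` of an event `E` (which may depend on the
sampled parameter `θ*`): `Σ_{θ*} π(θ*) · P_{θ*}^{⊗n}(E θ*)`, where `P_{θ*}^{⊗n}` is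
the product measure on `Z^n` with density `∏_i f_{θ*}(z_i)` w.r.t. `ρ^{⊗n}`. -/
def jointProb {Z : Type*} [MeasurableSpace Z] (ρ : Measure Z) [SigmaFinite ρ]
    {Θ : Type*} (π : Θ → ℝ) (f : Θ → Z → ℝ) (n : ℕ)
    (E : Θ → Set (Fin n → Z)) : ℝ≥0∞ :=
  ∑' θstar, ENNReal.ofReal (π θstar) *
    ((Measure.pi fun _ : Fin n => ρ).withDensity
      fun z => ENNReal.ofReal (∏ i, f θstar (z i))) (E θstar)

theorem ENNReal.tsum_rpow_le_tsum_rpow {ι : Type*} (a : ι → ℝ≥0∞) {p : ℝ} (hp : 0 < p)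
    (hp1 : p ≤ 1) : (∑' i, a i) ^ p ≤ ∑' i, a i ^ p := by
  rw [← ENNReal.le_rpow_inv_iff hp, ENNReal.tsum_eq_iSup_sum]
  refine iSup_le fun s => (ENNReal.le_rpow_inv_iff hp).2 ?_
  exact (Finset.le_sum_of_subadditive (fun x : ℝ≥0∞ => x ^ p) (by simp [hp])
    (fun x y => ENNReal.rpow_add_le_add_rpow x y hp.le hp1) s a).trans (ENNReal.sum_le_tsum s)

theorem ENNReal.ofReal_tsum_le {ι : Type*} {a : ι → ℝ} (ha : ∀ i, 0 ≤ a i) :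
    ENNReal.ofReal (∑' i, a i) ≤ ∑' i, ENNReal.ofReal (a i) := by
  by_cases h : Summable a
  · exact (ENNReal.ofReal_tsum_of_nonneg ha h).le
  · simp [tsum_eq_zero_of_not_summable h]

theorem lintegral_ofReal_prod_eq_pow {Z : Type*} [MeasurableSpace Z] {ρ : Measure Z}
    [SigmaFinite ρ] {g : Z → ℝ} (hg : Integrable g ρ) (hg0 : ∀ x, 0 ≤ g x) (n : ℕ) :
    ∫⁻ z, ENNReal.ofReal (∏ i, g (z i)) ∂(Measure.pi fun _ : Fin n => ρ) =
      ENNReal.ofReal ((∫ x, g x ∂ρ) ^ n) := by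
  rw [← ofReal_integral_eq_lintegral_ofReal (Integrable.fintype_prod fun _ => hg)
    (ae_of_all _ fun z => Finset.prod_nonneg fun i _ => hg0 _),
    integral_fintype_prod_eq_pow, Fintype.card_fin]

section Renyi

variable {Z : Type*} [MeasurableSpace Z] {ρ : Measure Z} {Θ : Type*} {f : Θ → Z → ℝ} {η : ℝ}
  {θstar θ : Θ}

theorem integrable_affinity (hf_meas : ∀ θ, Measurable (f θ)) (hf_pos : ∀ θ x, 0 < f θ x)
    (hf_int : ∀ θ, Integrable (f θ) ρ) (hη₀ : 0 ≤ η) (hη₁ : η ≤ 1) :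
    Integrable (fun x => f θstar x ^ (1 - η) * f θ x ^ η) ρ := by
  refine (((hf_int θstar).const_mul (1 - η)).add ((hf_int θ).const_mul η)).mono'
    (((hf_meas θstar).pow_const _).mul ((hf_meas θ).pow_const _)).aestronglyMeasurable
    (ae_of_all _ fun x => ?_)
  have h₁ := hf_pos θstar x
  have h₂ := hf_pos θ x
  rw [Real.norm_of_nonneg (by positivity)]
  exact Real.geom_mean_le_arith_mean2_weighted (by linarith) hη₀ h₁.le h₂.le (by ring)

theorem affinity_le_of_lt_renyi {ε : ℝ} (hη : 0 < η) (h : ε < renyi ρ f η θstar θ) :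
    ∫ x, f θstar x ^ (1 - η) * f θ x ^ η ∂ρ ≤ Real.exp (-(η * ε)) := by
  refine (Real.le_exp_log _).trans (Real.exp_le_exp.2 ?_)
  rw [renyi] at h
  have := mul_lt_mul_of_pos_left h hη
  have e : ∀ y : ℝ, η * (-(1 / η) * y) = -y := fun y => by field_simp
  rw [e] at this
  linarith

end Renyi

section Posterior

variable {Z : Type*} {Θ : Type*} {π : Θ → ℝ} {f : Θ → Z → ℝ}

theorem postNum_pos (hf_pos : ∀ θ x, 0 < f θ x) (hπ_pos : ∀ θ, 0 < π θ) {n : ℕ}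
    (z : Fin n → Z) (θ : Θ) : 0 < postNum π f z θ :=
  mul_pos (hπ_pos θ) (Finset.prod_pos fun i _ => hf_pos θ (z i))

theorem post_nonneg (hf_pos : ∀ θ x, 0 < f θ x) (hπ_pos : ∀ θ, 0 < π θ) {n : ℕ}
    (z : Fin n → Z) (θ : Θ) : 0 ≤ post π f z θ :=
  div_nonneg (postNum_pos hf_pos hπ_pos z θ).le
    (tsum_nonneg fun θ' => (postNum_pos hf_pos hπ_pos z θ').le)

theorem post_le_postNum_div (hf_pos : ∀ θ x, 0 < f θ x) (hπ_pos : ∀ θ, 0 < π θ) {n : ℕ}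
    (z : Fin n → Z) (θ θstar : Θ) :
    post π f z θ ≤ postNum π f z θ / postNum π f z θstar := by
  have hpos := postNum_pos hf_pos hπ_pos z
  by_cases h : Summable (postNum π f z)
  · exact div_le_div_of_nonneg_left (hpos θ).le (hpos θstar)
      (h.le_tsum θstar fun θ' _ => (hpos θ').le)
  · rw [post, tsum_eq_zero_of_not_summable h, _root_.div_zero]
    exact (div_pos (hpos θ) (hpos θstar)).le

theorem prod_mul_postNum_div_rpow (hf_pos : ∀ θ x, 0 < f θ x) (hπ_pos : ∀ θ, 0 < π θ) {n : ℕ}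
    (z : Fin n → Z) (η : ℝ) (θ θstar : Θ) :
    (∏ i, f θstar (z i)) * (postNum π f z θ / postNum π f z θstar) ^ η =
      π θ ^ η * π θstar ^ (-η) * ∏ i, (f θstar (z i) ^ (1 - η) * f θ (z i) ^ η) := by
  have h₁ : 0 < ∏ i, f θ (z i) := Finset.prod_pos fun i _ => hf_pos θ (z i)
  have h₂ : 0 < ∏ i, f θstar (z i) := Finset.prod_pos fun i _ => hf_pos θstar (z i)
  rw [Finset.prod_mul_distrib, Real.finsetProd_rpow _ _ fun i _ => (hf_pos θstar (z i)).le,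
    Real.finsetProd_rpow _ _ fun i _ => (hf_pos θ (z i)).le,
    Real.div_rpow (postNum_pos hf_pos hπ_pos z θ).le (postNum_pos hf_pos hπ_pos z θstar).le,
    postNum, postNum, Real.mul_rpow (hπ_pos θ).le h₁.le, Real.mul_rpow (hπ_pos θstar).le h₂.le,
    Real.rpow_neg (hπ_pos θstar).le, Real.rpow_sub h₂, Real.rpow_one]
  have h₃ := Real.rpow_pos_of_pos h₂ η
  have h₄ := Real.rpow_pos_of_pos (hπ_pos θstar) η
  field_simp

variable [MeasurableSpace Z]

theorem measurable_postNum (hf_meas : ∀ θ, Measurable (f θ)) (n : ℕ) (θ : Θ) :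
    Measurable fun z : Fin n → Z => postNum π f z θ :=
  (Finset.measurable_fun_prod _ fun i _ =>
    (hf_meas θ).comp (measurable_pi_apply i)).const_mul _

theorem measurable_odds_rpow (hf_meas : ∀ θ, Measurable (f θ)) (n : ℕ) (η : ℝ) (θ θstar : Θ) :
    Measurable fun z : Fin n → Z =>
      ENNReal.ofReal ((postNum π f z θ / postNum π f z θstar) ^ η) :=
  (((measurable_postNum hf_meas n θ).div
    (measurable_postNum hf_meas n θstar)).pow_const η).ennreal_ofReal

theorem measurable_ofReal_likelihood (hf_meas : ∀ θ, Measurable (f θ)) (n : ℕ) (θ : Θ) :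
    Measurable fun z : Fin n → Z => ENNReal.ofReal (∏ i, f θ (z i)) :=
  (Finset.measurable_fun_prod _ fun i _ =>
    (hf_meas θ).comp (measurable_pi_apply i)).ennreal_ofReal

variable {ρ : Measure Z} [SigmaFinite ρ]

/-- A single competitor `θ` at Rényi divergence more than `ε` has small expected power of its
posterior odds. -/
theorem lintegral_odds_rpow_le (hf_meas : ∀ θ, Measurable (f θ)) (hf_pos : ∀ θ x, 0 < f θ x)
    (hf_int : ∀ θ, Integrable (f θ) ρ) (hπ_pos : ∀ θ, 0 < π θ)
    {η : ℝ} (hη₀ : 0 < η) (hη₁ : η ≤ 1) (n : ℕ) {ε : ℝ} {θstar θ : Θ}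
    (h : ε < renyi ρ f η θstar θ) :
    ∫⁻ z, ENNReal.ofReal ((postNum π f z θ / postNum π f z θstar) ^ η)
        ∂((Measure.pi fun _ : Fin n => ρ).withDensity
          fun z => ENNReal.ofReal (∏ i, f θstar (z i))) ≤
      ENNReal.ofReal (π θ ^ η * π θstar ^ (-η) * Real.exp (-(η * ε)) ^ n) := by
  have hc : 0 ≤ π θ ^ η * π θstar ^ (-η) :=
    mul_nonneg (Real.rpow_nonneg (hπ_pos θ).le _) (Real.rpow_nonneg (hπ_pos θstar).le _)
  have hg0 : ∀ x, 0 ≤ f θstar x ^ (1 - η) * f θ x ^ η := fun x =>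
    mul_nonneg (Real.rpow_nonneg (hf_pos θstar x).le _) (Real.rpow_nonneg (hf_pos θ x).le _)
  rw [lintegral_withDensity_eq_lintegral_mul _ (measurable_ofReal_likelihood hf_meas n θstar)
    (measurable_odds_rpow hf_meas n η θ θstar)]
  simp only [Pi.mul_apply]
  simp_rw [← ENNReal.ofReal_mul (Finset.prod_nonneg fun i _ => (hf_pos θstar _).le),
    prod_mul_postNum_div_rpow hf_pos hπ_pos, ENNReal.ofReal_mul hc]
  rw [lintegral_const_mul' _ _ ENNReal.ofReal_ne_top, lintegral_ofReal_prod_eq_pow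
    (integrable_affinity hf_meas hf_pos hf_int hη₀.le hη₁) hg0]
  gcongr
  · exact integral_nonneg hg0
  · exact affinity_le_of_lt_renyi hη₀ h

/-- Conditionally on `θstar`, the posterior mass of the parameters at Rényi divergence more than
`ε` from `θstar` is unlikely to be at least `t`. -/
theorem measure_posterior_far_le [Countable Θ] (hf_meas : ∀ θ, Measurable (f θ))
    (hf_pos : ∀ θ x, 0 < f θ x) (hf_int : ∀ θ, Integrable (f θ) ρ) (hπ_pos : ∀ θ, 0 < π θ)
    {η : ℝ} (hη₀ : 0 < η) (hη₁ : η ≤ 1) (hsum : Summable fun θ => π θ ^ η)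
    (n : ℕ) (ε : ℝ) {t : ℝ} (ht : 0 < t) (θstar : Θ) :
    ((Measure.pi fun _ : Fin n => ρ).withDensity
        fun z => ENNReal.ofReal (∏ i, f θstar (z i)))
        {z | t ≤ ∑' θ : {θ : Θ // ε < renyi ρ f η θstar θ}, post π f z θ.1} ≤
      ENNReal.ofReal ((∑' θ, π θ ^ η) * (π θstar ^ (-η) * Real.exp (-(η * ε)) ^ n * t ^ (-η))) := by
  set P := (Measure.pi fun _ : Fin n => ρ).withDensity
    fun z => ENNReal.ofReal (∏ i, f θstar (z i))
  set far := {θ : Θ // ε < renyi ρ f η θstar θ}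
  set K := π θstar ^ (-η) * Real.exp (-(η * ε)) ^ n
  have hK : 0 ≤ K := mul_nonneg (Real.rpow_nonneg (hπ_pos θstar).le _) (by positivity)
  let odds : far → (Fin n → Z) → ℝ≥0∞ := fun θ z =>
    ENNReal.ofReal ((postNum π f z θ.1 / postNum π f z θstar) ^ η)
  have hodds : ∀ θ, Measurable (odds θ) := fun θ => measurable_odds_rpow hf_meas n η θ.1 θstar
  have hsub : {z : Fin n → Z | t ≤ ∑' θ : far, post π f z θ.1} ⊆
      {z | ENNReal.ofReal (t ^ η) ≤ ∑' θ, odds θ z} := by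
    intro z hz
    calc ENNReal.ofReal (t ^ η) = ENNReal.ofReal t ^ η :=
          (ENNReal.ofReal_rpow_of_pos ht).symm
      _ ≤ (∑' θ : far, ENNReal.ofReal (post π f z θ.1)) ^ η := by
          refine ENNReal.rpow_le_rpow ((ENNReal.ofReal_le_ofReal hz).trans ?_) hη₀.le
          exact ENNReal.ofReal_tsum_le fun θ => post_nonneg hf_pos hπ_pos z θ.1
      _ ≤ ∑' θ : far, ENNReal.ofReal (post π f z θ.1) ^ η :=
          ENNReal.tsum_rpow_le_tsum_rpow _ hη₀ hη₁
      _ ≤ ∑' θ, odds θ z := by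
          refine ENNReal.tsum_le_tsum fun θ => ?_
          rw [ENNReal.ofReal_rpow_of_nonneg (post_nonneg hf_pos hπ_pos z θ.1) hη₀.le]
          exact ENNReal.ofReal_le_ofReal (Real.rpow_le_rpow (post_nonneg hf_pos hπ_pos z θ.1)
            (post_le_postNum_div hf_pos hπ_pos z θ.1 θstar) hη₀.le)
  have hπη : ∀ θ, 0 ≤ π θ ^ η := fun θ => Real.rpow_nonneg (hπ_pos θ).le _
  have hint : ∫⁻ z, ∑' θ, odds θ z ∂P ≤ ENNReal.ofReal ((∑' θ, π θ ^ η) * K) := by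
    rw [lintegral_tsum fun θ => (hodds θ).aemeasurable]
    calc ∑' θ : far, ∫⁻ z, odds θ z ∂P
        ≤ ∑' θ : far, ENNReal.ofReal (π θ.1 ^ η) * ENNReal.ofReal K := by
          refine ENNReal.tsum_le_tsum fun θ => ?_
          rw [← ENNReal.ofReal_mul (hπη _), ← mul_assoc]
          exact lintegral_odds_rpow_le hf_meas hf_pos hf_int hπ_pos hη₀ hη₁ n θ.2
      _ ≤ (∑' θ, ENNReal.ofReal (π θ ^ η)) * ENNReal.ofReal K := by
          rw [ENNReal.tsum_mul_right]
          gcongr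
          exact ENNReal.tsum_comp_le_tsum_of_injective Subtype.val_injective
            fun θ => ENNReal.ofReal (π θ ^ η)
      _ = ENNReal.ofReal ((∑' θ, π θ ^ η) * K) := by
          rw [← ENNReal.ofReal_tsum_of_nonneg hπη hsum,
            ENNReal.ofReal_mul (tsum_nonneg hπη)]
  have htη : 0 < t ^ η := Real.rpow_pos_of_pos ht η
  calc P {z : Fin n → Z | t ≤ ∑' θ : far, post π f z θ.1}
      ≤ P {z | ENNReal.ofReal (t ^ η) ≤ ∑' θ, odds θ z} := measure_mono hsub
    _ ≤ (∫⁻ z, ∑' θ, odds θ z ∂P) / ENNReal.ofReal (t ^ η) :=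
        meas_ge_le_lintegral_div (Measurable.tsum hodds).aemeasurable
          (by simpa using htη) ENNReal.ofReal_ne_top
    _ ≤ ENNReal.ofReal ((∑' θ, π θ ^ η) * K) / ENNReal.ofReal (t ^ η) := by gcongr
    _ = ENNReal.ofReal ((∑' θ, π θ ^ η) * (K * t ^ (-η))) := by
        rw [← ENNReal.ofReal_div_of_pos htη, Real.rpow_neg ht.le, div_eq_mul_inv, mul_assoc]

theorem measure_withDensity_likelihood_le_one (hf_pos : ∀ θ x, 0 < f θ x)
    (hf_int : ∀ θ, ∫ x, f θ x ∂ρ = 1) (n : ℕ) (θ : Θ) (s : Set (Fin n → Z)) :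
    ((Measure.pi fun _ : Fin n => ρ).withDensity
      fun z => ENNReal.ofReal (∏ i, f θ (z i))) s ≤ 1 := by
  refine (measure_mono (Set.subset_univ s)).trans_eq ?_
  have hi : Integrable (f θ) ρ := Integrable.of_integral_ne_zero (by simp [hf_int])
  rw [withDensity_apply _ MeasurableSet.univ, Measure.restrict_univ,
    lintegral_ofReal_prod_eq_pow hi (fun x => (hf_pos θ x).le), hf_int]
  simp

end Posterior

/-- Lemma 1: the Bayesian believes the posterior concentrates in Rényi divergence.
With `ε = (b log n)/(nη)` and `c_η = (1-η)/(1+η(1-η))`,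
`Π( (θ*,Z^n) : Σ_{θ : d_η(θ*‖θ) > ε} π(θ | Z^n) ≥ n^{-b c_η} ) ≤ 2 (Σ_θ π(θ)^η) n^{-b c_η}`. -/
theorem bayesian_posterior_concentration_renyi
    {Z : Type*} [MeasurableSpace Z] (ρ : Measure Z) [SigmaFinite ρ]
    {Θ : Type*} [Countable Θ]
    (f : Θ → Z → ℝ) (hf_meas : ∀ θ, Measurable (f θ))
    (hf_pos : ∀ θ x, 0 < f θ x)
    (hf_int : ∀ θ, ∫ x, f θ x ∂ρ = 1)
    (π : Θ → ℝ) (hπ_pos : ∀ θ, 0 < π θ) (hπ_sum : ∑' θ, π θ = 1)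
    (η : ℝ) (hη₁ : 1 / 2 ≤ η) (hη₂ : η < 1)
    (hsum : Summable fun θ => π θ ^ η)
    (b : ℝ) (hb : 0 < b) (n : ℕ) (hn : 2 ≤ n) :
    jointProb ρ π f n
        (fun θstar =>
          {z | (n : ℝ) ^ (-(b * ((1 - η) / (1 + η * (1 - η))))) ≤
            ∑' θ : {θ : Θ // b * Real.log n / (n * η) < renyi ρ f η θstar θ},
              post π f z θ.1})
      ≤ ENNReal.ofReal
          (2 * (∑' θ, π θ ^ η) * (n : ℝ) ^ (-(b * ((1 - η) / (1 + η * (1 - η)))))) := by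
  have hη₀ : 0 < η := by linarith
  have hn₀ : 0 < (n : ℝ) := by positivity
  have hD : 0 < 1 + η * (1 - η) := by nlinarith
  set ε := b * Real.log n / (n * η) with hε
  set t := (n : ℝ) ^ (-(b * ((1 - η) / (1 + η * (1 - η))))) with ht_def
  set s := (n : ℝ) ^ (-(b / (1 + η * (1 - η)))) with hs_def
  set S := ∑' θ, π θ ^ η
  have ht : 0 < t := Real.rpow_pos_of_pos hn₀ _
  have hs : 0 < s := Real.rpow_pos_of_pos hn₀ _
  have hπη : ∀ θ, 0 ≤ π θ ^ η := fun θ => Real.rpow_nonneg (hπ_pos θ).le _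
  have hS : 0 ≤ S := tsum_nonneg hπη
  have hπ_summable : Summable π := by
    by_contra h
    simp [tsum_eq_zero_of_not_summable h] at hπ_sum
  have hexp : Real.exp (-(η * ε)) ^ n = (n : ℝ) ^ (-b) := by
    rw [← Real.exp_nat_mul, Real.rpow_def_of_pos hn₀, hε]
    congr 1
    field_simp
  have hs_pow : s ^ (1 - η) = t := by
    rw [hs_def, ht_def, ← Real.rpow_mul hn₀.le]
    congr 1
    ring
  have hst : s ^ (-η) * (n : ℝ) ^ (-b) * t ^ (-η) = t := by
    rw [hs_def, ht_def, ← Real.rpow_mul hn₀.le, ← Real.rpow_mul hn₀.le, ← Real.rpow_add hn₀,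
      ← Real.rpow_add hn₀]
    congr 1
    field_simp
    ring
  have hint : ∀ θ, Integrable (f θ) ρ := fun θ =>
    Integrable.of_integral_ne_zero (by simp [hf_int])
  have hbound : ∀ θ, 0 ≤ t * π θ ^ η + π θ * (S * t) := fun θ =>
    add_nonneg (mul_nonneg ht.le (hπη θ)) (mul_nonneg (hπ_pos θ).le (mul_nonneg hS ht.le))
  have hsum₁ := hsum.mul_left t
  have hsum₂ := hπ_summable.mul_right (S * t)
  calc _ ≤ ∑' θ, ENNReal.ofReal (t * π θ ^ η + π θ * (S * t)) := by
        refine ENNReal.tsum_le_tsum fun θ => ?_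
        rcases lt_or_ge (π θ) s with h | h
        · refine (mul_le_of_le_one_right'
            (measure_withDensity_likelihood_le_one hf_pos hf_int n θ _)).trans
            (ENNReal.ofReal_le_ofReal ?_)
          calc π θ = π θ ^ (1 - η) * π θ ^ η := by
                rw [← Real.rpow_add (hπ_pos θ), sub_add_cancel, Real.rpow_one]
            _ ≤ t * π θ ^ η := by
                rw [← hs_pow]
                exact mul_le_mul_of_nonneg_right
                  (Real.rpow_le_rpow (hπ_pos θ).le h.le (by linarith)) (hπη θ)
            _ ≤ _ := le_add_of_nonneg_right
                (mul_nonneg (hπ_pos θ).le (mul_nonneg hS ht.le))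
        · refine (mul_le_mul_right (measure_posterior_far_le hf_meas hf_pos hint hπ_pos hη₀
            hη₂.le hsum n ε ht θ) _).trans ?_
          rw [← ENNReal.ofReal_mul (hπ_pos θ).le, hexp]
          refine ENNReal.ofReal_le_ofReal ?_
          calc π θ * (S * (π θ ^ (-η) * (n : ℝ) ^ (-b) * t ^ (-η)))
              ≤ π θ * (S * (s ^ (-η) * (n : ℝ) ^ (-b) * t ^ (-η))) := by
                have := (hπ_pos θ).le
                have := Real.rpow_le_rpow_of_nonpos hs h (neg_nonpos.2 hη₀.le)
                gcongr
            _ = π θ * (S * t) := by rw [hst]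
            _ ≤ _ := le_add_of_nonneg_left (mul_nonneg ht.le (hπη θ))
    _ = ENNReal.ofReal (2 * S * t) := by
        rw [← ENNReal.ofReal_tsum_of_nonneg hbound (hsum₁.add hsum₂), hsum₁.tsum_add hsum₂,
          tsum_mul_left, tsum_mul_right, hπ_sum]
        congr 1
        ring
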